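/- arXiv:1903.01375 — 2 statements merged into one kernel-verified Lean document; each statement's English description precedes it below -/
import Mathlib

section
/- In three-player normal play, *+*+* ≠ 0: there exists a game X (namely X = {{0, *+*}}) such that o(*+*+*+X) ≠ o(0+X). -/
inductive IGame : Type where
  | mk : List IGame → IGame

namespace IGame

def opts : IGame → List IGame
  | mk l => l

theorem sizeOf_lt_of_mem {g G : IGame} (h : g ∈ G.opts) : sizeOf g < sizeOf G := by
  cases G with
  | mk l =>
    have h2 : g ∈ l := h
    have := List.sizeOf_lt_of_mem h2
    simp only [mk.sizeOf_spec]
    omega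

def add : IGame → IGame → IGame
  | G, H =>
    mk ((G.opts.attach.map fun g => add g.1 H) ++ (H.opts.attach.map fun h => add G h.1))
termination_by G H => sizeOf G + sizeOf H
decreasing_by
  · have := sizeOf_lt_of_mem g.2; omega
  · have := sizeOf_lt_of_mem h.2; omega

inductive Player : Type where
  | N | O | P
  deriving DecidableEq

def out : IGame → Player → Prop
  | G, .N => ∃ g : {x // x ∈ G.opts}, out g.1 .P
  | G, .O => ∀ g : {x // x ∈ G.opts}, out g.1 .N
  | G, .P => ∀ g : {x // x ∈ G.opts}, out g.1 .O
termination_by G _ => sizeOf G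
decreasing_by
  all_goals exact sizeOf_lt_of_mem g.2

theorem out_N {G : IGame} : out G .N ↔ ∃ g ∈ G.opts, out g .P := by
  rw [out]
  exact ⟨fun ⟨g, h⟩ => ⟨g.1, g.2, h⟩, fun ⟨g, hm, h⟩ => ⟨⟨g, hm⟩, h⟩⟩

theorem out_O {G : IGame} : out G .O ↔ ∀ g ∈ G.opts, out g .N := by
  rw [out]
  exact ⟨fun h g hm => h ⟨g, hm⟩, fun h g => h g.1 g.2⟩

theorem out_P {G : IGame} : out G .P ↔ ∀ g ∈ G.opts, out g .O := by
  rw [out]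
  exact ⟨fun h g hm => h ⟨g, hm⟩, fun h g => h g.1 g.2⟩

def outcome (G : IGame) : Set Player := {p | out G p}

def nim : Nat → IGame
  | 0 => mk []
  | n+1 => mk ((nim n).opts ++ [nim n])

end IGame

theorem IGame.add_mk (a b : List IGame) : IGame.add (IGame.mk a) (IGame.mk b) =
    IGame.mk ((a.map fun g => IGame.add g (IGame.mk b)) ++
      (b.map fun h => IGame.add (IGame.mk a) h)) := by
  rw [IGame.add]
  simp [IGame.opts]

theorem IGame.mk_N (l : List IGame) : out (mk l) .N ↔ ∃ g ∈ l, out g .P := out_N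

theorem IGame.mk_O (l : List IGame) : out (mk l) .O ↔ ∀ g ∈ l, out g .N := out_O

theorem IGame.mk_P (l : List IGame) : out (mk l) .P ↔ ∀ g ∈ l, out g .O := out_P

open IGame in
/-- `*+*+* ≠ 0`: the game `X = {{0, *+*}}` distinguishes them. -/
theorem three_star_ne_zero :
    IGame.outcome (IGame.add (IGame.add (IGame.add (IGame.nim 1) (IGame.nim 1)) (IGame.nim 1))
        (IGame.mk [IGame.mk [IGame.mk [], IGame.add (IGame.nim 1) (IGame.nim 1)]])) ≠
    IGame.outcome (IGame.add (IGame.mk [])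
        (IGame.mk [IGame.mk [IGame.mk [], IGame.add (IGame.nim 1) (IGame.nim 1)]])) := by
  intro h
  have h2 := congrArg (fun s : Set Player => Player.O ∈ s) h
  simp [outcome, nim, add_mk, opts, mk_N, mk_O, mk_P] at h2
end

section
/- In three-player Nim, the position *3 + *3 + *3 (three heaps each of size 3) is an absorbing game: its sum with any impartial game is undetermined. More generally, *m1 + *m2 + *m3 is absorbing whenever m1, m2, m3 ≥ 3. -/
namespace IGame

theorem opts_add (G H : IGame) :
    (add G H).opts = (G.opts.map fun g => add g H) ++ (H.opts.map fun h => add G h) := by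
  rw [add]
  simp [opts]

theorem mem_opts_add {G H x : IGame} :
    x ∈ (add G H).opts ↔ (∃ g ∈ G.opts, add g H = x) ∨ (∃ h ∈ H.opts, add G h = x) := by
  rw [opts_add]; simp

theorem mem_opts_nim {n : ℕ} {x : IGame} : x ∈ (nim n).opts ↔ ∃ k < n, nim k = x := by
  induction n with
  | zero => simp [nim, opts]
  | succ n ih =>
    have : (nim (n+1)).opts = (nim n).opts ++ [nim n] := by rw [nim, opts]
    rw [this, List.mem_append, ih, List.mem_singleton]
    constructor
    · rintro (⟨k, hk, rfl⟩ | rfl)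
      · exact ⟨k, by omega, rfl⟩
      · exact ⟨n, by omega, rfl⟩
    · rintro ⟨k, hk, rfl⟩
      rcases Nat.lt_succ_iff_lt_or_eq.1 hk with h | rfl
      · exact Or.inl ⟨k, h, rfl⟩
      · exact Or.inr rfl

/-- outcome of `*a + *b + *c + D` -/
def u (D : IGame) (a b c : ℕ) (p : Player) : Prop :=
  out (add (add (add (nim a) (nim b)) (nim c)) D) p

theorem mem4 {D x : IGame} {a b c : ℕ} :
    x ∈ (add (add (add (nim a) (nim b)) (nim c)) D).opts ↔
      (∃ k < a, add (add (add (nim k) (nim b)) (nim c)) D = x) ∨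
      (∃ k < b, add (add (add (nim a) (nim k)) (nim c)) D = x) ∨
      (∃ k < c, add (add (add (nim a) (nim b)) (nim k)) D = x) ∨
      (∃ d ∈ D.opts, add (add (add (nim a) (nim b)) (nim c)) d = x) := by
  simp only [mem_opts_add, mem_opts_nim]
  constructor
  · rintro (⟨_, ⟨_, ⟨_, ⟨k, hk, rfl⟩, rfl⟩ | ⟨_, ⟨k, hk, rfl⟩, rfl⟩, rfl⟩ |
      ⟨_, ⟨k, hk, rfl⟩, rfl⟩, rfl⟩ | ⟨d, hd, rfl⟩)
    · exact Or.inl ⟨k, hk, rfl⟩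
    · exact Or.inr (Or.inl ⟨k, hk, rfl⟩)
    · exact Or.inr (Or.inr (Or.inl ⟨k, hk, rfl⟩))
    · exact Or.inr (Or.inr (Or.inr ⟨d, hd, rfl⟩))
  · rintro (⟨k, hk, rfl⟩ | ⟨k, hk, rfl⟩ | ⟨k, hk, rfl⟩ | ⟨d, hd, rfl⟩)
    · exact Or.inl ⟨_, Or.inl ⟨_, Or.inl ⟨_, ⟨k, hk, rfl⟩, rfl⟩, rfl⟩, rfl⟩
    · exact Or.inl ⟨_, Or.inl ⟨_, Or.inr ⟨_, ⟨k, hk, rfl⟩, rfl⟩, rfl⟩, rfl⟩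
    · exact Or.inl ⟨_, Or.inr ⟨_, ⟨k, hk, rfl⟩, rfl⟩, rfl⟩
    · exact Or.inr ⟨d, hd, rfl⟩

theorem u_N {D : IGame} {a b c : ℕ} : u D a b c .N ↔
    (∃ k < a, u D k b c .P) ∨ (∃ k < b, u D a k c .P) ∨ (∃ k < c, u D a b k .P) ∨
      (∃ d ∈ D.opts, u d a b c .P) := by
  unfold u
  rw [out_N]
  constructor
  · rintro ⟨g, hg, h⟩
    rcases mem4.1 hg with ⟨k, hk, rfl⟩ | ⟨k, hk, rfl⟩ | ⟨k, hk, rfl⟩ | ⟨d, hd, rfl⟩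
    · exact Or.inl ⟨k, hk, h⟩
    · exact Or.inr (Or.inl ⟨k, hk, h⟩)
    · exact Or.inr (Or.inr (Or.inl ⟨k, hk, h⟩))
    · exact Or.inr (Or.inr (Or.inr ⟨d, hd, h⟩))
  · rintro (⟨k, hk, h⟩ | ⟨k, hk, h⟩ | ⟨k, hk, h⟩ | ⟨d, hd, h⟩)
    · exact ⟨_, mem4.2 (Or.inl ⟨k, hk, rfl⟩), h⟩
    · exact ⟨_, mem4.2 (Or.inr (Or.inl ⟨k, hk, rfl⟩)), h⟩
    · exact ⟨_, mem4.2 (Or.inr (Or.inr (Or.inl ⟨k, hk, rfl⟩))), h⟩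
    · exact ⟨_, mem4.2 (Or.inr (Or.inr (Or.inr ⟨d, hd, rfl⟩))), h⟩

theorem forall4 {D : IGame} {a b c : ℕ} {p : Player} :
    (∀ g ∈ (add (add (add (nim a) (nim b)) (nim c)) D).opts, out g p) ↔
    (∀ k < a, u D k b c p) ∧ (∀ k < b, u D a k c p) ∧ (∀ k < c, u D a b k p) ∧
      (∀ d ∈ D.opts, u d a b c p) := by
  constructor
  · intro h
    exact ⟨fun k hk => h _ (mem4.2 (Or.inl ⟨k, hk, rfl⟩)),
      fun k hk => h _ (mem4.2 (Or.inr (Or.inl ⟨k, hk, rfl⟩))),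
      fun k hk => h _ (mem4.2 (Or.inr (Or.inr (Or.inl ⟨k, hk, rfl⟩)))),
      fun d hd => h _ (mem4.2 (Or.inr (Or.inr (Or.inr ⟨d, hd, rfl⟩))))⟩
  · rintro ⟨h1, h2, h3, h4⟩ g hg
    rcases mem4.1 hg with ⟨k, hk, rfl⟩ | ⟨k, hk, rfl⟩ | ⟨k, hk, rfl⟩ | ⟨d, hd, rfl⟩
    · exact h1 k hk
    · exact h2 k hk
    · exact h3 k hk
    · exact h4 d hd

theorem u_O {D : IGame} {a b c : ℕ} : u D a b c .O ↔
    (∀ k < a, u D k b c .N) ∧ (∀ k < b, u D a k c .N) ∧ (∀ k < c, u D a b k .N) ∧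
      (∀ d ∈ D.opts, u d a b c .N) := by
  rw [← forall4]; unfold u; rw [out_O]

theorem u_P {D : IGame} {a b c : ℕ} : u D a b c .P ↔
    (∀ k < a, u D k b c .O) ∧ (∀ k < b, u D a k c .O) ∧ (∀ k < c, u D a b k .O) ∧
      (∀ d ∈ D.opts, u d a b c .O) := by
  rw [← forall4]; unfold u; rw [out_P]

theorem u_symm (n : ℕ) : ∀ (D : IGame) (a b c : ℕ) (p : Player), a + b + c + sizeOf D < n →
    u D a b c p → (u D b a c p ∧ u D a c b p) := by
  induction n with
  | zero => intro D a b c p h; omega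
  | succ n ih =>
    intro D a b c p hn h
    have ihd : ∀ d ∈ D.opts, ∀ p, u d a b c p → (u d b a c p ∧ u d a c b p) := by
      intro d hd p h
      have := sizeOf_lt_of_mem hd
      exact ih d a b c p (by omega) h
    have iha : ∀ k < a, ∀ p, u D k b c p → (u D b k c p ∧ u D k c b p) :=
      fun k hk p h => ih D k b c p (by omega) h
    have ihb : ∀ k < b, ∀ p, u D a k c p → (u D k a c p ∧ u D a c k p) :=
      fun k hk p h => ih D a k c p (by omega) h
    have ihc : ∀ k < c, ∀ p, u D a b k p → (u D b a k p ∧ u D a k b p) :=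
      fun k hk p h => ih D a b k p (by omega) h
    cases p with
    | N =>
      rw [u_N] at h
      rw [u_N, u_N]
      rcases h with ⟨k, hk, h⟩ | ⟨k, hk, h⟩ | ⟨k, hk, h⟩ | ⟨d, hd, h⟩
      · have := iha k hk _ h
        exact ⟨Or.inr (Or.inl ⟨k, hk, this.1⟩), Or.inl ⟨k, hk, this.2⟩⟩
      · have := ihb k hk _ h
        exact ⟨Or.inl ⟨k, hk, this.1⟩, Or.inr (Or.inr (Or.inl ⟨k, hk, this.2⟩))⟩
      · have := ihc k hk _ h
        exact ⟨Or.inr (Or.inr (Or.inl ⟨k, hk, this.1⟩)), Or.inr (Or.inl ⟨k, hk, this.2⟩)⟩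
      · have := ihd d hd _ h
        exact ⟨Or.inr (Or.inr (Or.inr ⟨d, hd, this.1⟩)), Or.inr (Or.inr (Or.inr ⟨d, hd, this.2⟩))⟩
    | O =>
      rw [u_O] at h
      rw [u_O, u_O]
      obtain ⟨h1, h2, h3, h4⟩ := h
      exact ⟨⟨fun k hk => (ihb k hk _ (h2 k hk)).1, fun k hk => (iha k hk _ (h1 k hk)).1,
        fun k hk => (ihc k hk _ (h3 k hk)).1, fun d hd => (ihd d hd _ (h4 d hd)).1⟩,
        ⟨fun k hk => (iha k hk _ (h1 k hk)).2, fun k hk => (ihc k hk _ (h3 k hk)).2,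
        fun k hk => (ihb k hk _ (h2 k hk)).2, fun d hd => (ihd d hd _ (h4 d hd)).2⟩⟩
    | P =>
      rw [u_P] at h
      rw [u_P, u_P]
      obtain ⟨h1, h2, h3, h4⟩ := h
      exact ⟨⟨fun k hk => (ihb k hk _ (h2 k hk)).1, fun k hk => (iha k hk _ (h1 k hk)).1,
        fun k hk => (ihc k hk _ (h3 k hk)).1, fun d hd => (ihd d hd _ (h4 d hd)).1⟩,
        ⟨fun k hk => (iha k hk _ (h1 k hk)).2, fun k hk => (ihc k hk _ (h3 k hk)).2,
        fun k hk => (ihb k hk _ (h2 k hk)).2, fun d hd => (ihd d hd _ (h4 d hd)).2⟩⟩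

/-- Abstract form: a well-founded family of games `H`, and the outcomes of `H + *i + *j`. -/
structure Sys (T : Type) where
  r : T → T → Prop
  wf : WellFounded r
  w : T → ℕ → ℕ → Player → Prop
  sy : ∀ {H i j p}, w H i j p → w H j i p
  Pl : ∀ {H i j}, w H i j .P → ∀ k < i, w H k j .O
  Ph : ∀ {H i j}, w H i j .P → ∀ {H'}, r H' H → w H' i j .O
  Ol : ∀ {H i j}, w H i j .O → ∀ k < i, w H k j .N
  Oh : ∀ {H i j}, w H i j .O → ∀ {H'}, r H' H → w H' i j .N
  Nc : ∀ {H i j}, w H i j .N → (∃ k < i, w H k j .P) ∨ (∃ k < j, w H i k .P) ∨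
    ∃ H', r H' H ∧ w H' i j .P

namespace Sys
variable {T : Type} (S : Sys T)

theorem Pr {H : T} {i j : ℕ} (h : S.w H i j .P) (k : ℕ) (hk : k < j) : S.w H i k .O :=
  S.sy (S.Pl (S.sy h) k hk)

theorem Or {H : T} {i j : ℕ} (h : S.w H i j .O) (k : ℕ) (hk : k < j) : S.w H i k .N :=
  S.sy (S.Ol (S.sy h) k hk)

/-- No position is a win for all three players. -/
theorem triv (H : T) : ∀ (n i j : ℕ), i + j < n →
    S.w H i j .N → S.w H i j .O → S.w H i j .P → False := by
  induction H using S.wf.induction with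
  | _ H ihH =>
    intro n
    induction n with
    | zero => intro i j h; omega
    | succ n ih =>
      intro i j hn hN hO hP
      rcases S.Nc hN with ⟨k, hk, h⟩ | ⟨k, hk, h⟩ | ⟨H', hr, h⟩
      · exact ih k j (by omega) (S.Ol hO k hk) (S.Pl hP k hk) h
      · exact ih i k (by omega) (S.Or hO k hk) (S.Pr hP k hk) h
      · exact ihH H' hr (i + j + 1) i j (by omega) (S.Oh hO hr) (S.Ph hP hr) h

theorem triv' {H : T} {i j : ℕ} (hN : S.w H i j .N) (hO : S.w H i j .O) (hP : S.w H i j .P) :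
    False := S.triv H (i + j + 1) i j (by omega) hN hO hP

theorem C (H : T) :
    (S.w H 0 0 .P → S.w H 0 1 .O → S.w H 1 1 .N → False) ∧
    (S.w H 0 0 .O → S.w H 0 1 .N → S.w H 1 1 .P → False) ∧
    (S.w H 0 0 .N → S.w H 0 1 .P → S.w H 1 1 .O → False) := by
  induction H using S.wf.induction with
  | _ H ih =>
    refine ⟨fun h0 h1 h11 => ?_, fun h0 h1 h11 => ?_, fun h0 h1 h11 => ?_⟩
    · have n0 := S.Or h1 0 (by omega)
      rcases S.Nc h11 with ⟨k, hk, h⟩ | ⟨k, hk, h⟩ | ⟨H', hr, h⟩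
      · obtain rfl : k = 0 := by omega
        exact S.triv' n0 (S.Pr h 0 (by omega)) h0
      · obtain rfl : k = 0 := by omega
        exact S.triv' n0 (S.Pl h 0 (by omega)) h0
      · exact (ih H' hr).2.1 (S.Ph h0 hr) (S.Oh h1 hr) h
    · have o1 := S.Pl h11 0 (by omega)
      have n0 := S.Or o1 0 (by omega)
      rcases S.Nc h1 with ⟨k, hk, h⟩ | ⟨k, hk, h⟩ | ⟨H', hr, h⟩
      · omega
      · obtain rfl : k = 0 := by omega
        exact S.triv' n0 h0 h
      · exact (ih H' hr).2.2 (S.Oh h0 hr) h (S.Ph h11 hr)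
    · rcases S.Nc h0 with ⟨k, hk, h⟩ | ⟨k, hk, h⟩ | ⟨H', hr, h⟩
      · omega
      · omega
      · exact (ih H' hr).1 h (S.Ph h1 hr) (S.Oh h11 hr)

theorem N0 {H : T} (h : S.w H 0 0 .N) : ∃ H', S.r H' H ∧ S.w H' 0 0 .P := by
  rcases S.Nc h with ⟨k, hk, _⟩ | ⟨k, hk, _⟩ | h
  · omega
  · omega
  · exact h

theorem N1 {H : T} (h : S.w H 0 1 .N) : S.w H 0 0 .P ∨ ∃ H', S.r H' H ∧ S.w H' 0 1 .P := by
  rcases S.Nc h with ⟨k, hk, _⟩ | ⟨k, hk, h⟩ | h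
  · omega
  · obtain rfl : k = 0 := by omega
    exact .inl h
  · exact .inr h

theorem N11 {H : T} (h : S.w H 1 1 .N) : S.w H 0 1 .P ∨ ∃ H', S.r H' H ∧ S.w H' 1 1 .P := by
  rcases S.Nc h with ⟨k, hk, h⟩ | ⟨k, hk, h⟩ | h
  · obtain rfl : k = 0 := by omega
    exact .inl h
  · obtain rfl : k = 0 := by omega
    exact .inl (S.sy h)
  · exact .inr h

theorem N22 {H : T} (h : S.w H 2 2 .N) :
    (S.w H 0 1 .O ∧ (S.w H 0 2 .P ∨ S.w H 1 2 .P)) ∨ ∃ H', S.r H' H ∧ S.w H' 2 2 .P := by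
  have key : ∀ k < 2, S.w H k 2 .P → (S.w H 0 1 .O ∧ (S.w H 0 2 .P ∨ S.w H 1 2 .P)) := by
    intro k hk h
    obtain rfl | rfl : k = 0 ∨ k = 1 := by omega
    · exact ⟨S.Pr h 1 (by omega), .inl h⟩
    · exact ⟨S.sy (S.Pr h 0 (by omega)), .inr h⟩
  rcases S.Nc h with ⟨k, hk, h⟩ | ⟨k, hk, h⟩ | h
  · exact .inl (key k hk h)
  · exact .inl (key k hk (S.sy h))
  · exact .inr h

theorem P_N0 {H : T} {i j : ℕ} (h : S.w H i j .P) (hij : 2 ≤ i + j) : S.w H 0 0 .N := by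
  rcases Nat.eq_zero_or_pos i with rfl | hi
  · exact S.Or (S.Pr h 1 (by omega)) 0 (by omega)
  · rcases Nat.eq_zero_or_pos j with rfl | hj
    · exact S.Ol (S.Pl h 1 (by omega)) 0 (by omega)
    · exact S.Or (S.Pl h 0 hi) 0 hj

theorem D (m : ℕ) (hm : 2 ≤ m) (H : T) :
    (S.w H 0 0 .O → S.w H 0 0 .P → S.w H 2 m .N → False) ∧
    (S.w H 0 0 .N → S.w H 0 0 .O → S.w H 2 m .P → False) ∧
    (S.w H 0 0 .N → S.w H 0 0 .P → S.w H 2 m .O → False) := by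
  induction H using S.wf.induction with
  | _ H ih =>
    refine ⟨fun h0 h1 h2 => ?_, fun h0 h1 h2 => ?_, fun h0 h1 h2 => ?_⟩
    · rcases S.Nc h2 with ⟨k, hk, h⟩ | ⟨k, hk, h⟩ | ⟨H', hr, h⟩
      · exact S.triv' (S.P_N0 h (by omega)) h0 h1
      · exact S.triv' (S.P_N0 h (by omega)) h0 h1
      · exact (ih H' hr).2.1 (S.Oh h0 hr) (S.Ph h1 hr) h
    · obtain ⟨H', hr, h⟩ := S.N0 h0
      exact (ih H' hr).2.2 (S.Oh h1 hr) h (S.Ph h2 hr)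
    · obtain ⟨H', hr, h⟩ := S.N0 h0
      exact (ih H' hr).1 (S.Ph h1 hr) h (S.Oh h2 hr)

theorem E (H : T) :
    (S.w H 0 1 .N → S.w H 0 1 .P → S.w H 1 1 .O → S.w H 2 2 .N → False) ∧
    (S.w H 0 1 .O → S.w H 2 2 .P → False) ∧
    (S.w H 0 1 .N → S.w H 1 1 .P → S.w H 2 2 .O → False) := by
  induction H using S.wf.induction with
  | _ H ih =>
    refine ⟨fun n1 p1 o11 n22 => ?_, fun o1 p22 => ?_, fun n1 p11 o22 => ?_⟩
    · rcases S.N22 n22 with ⟨o1, _⟩ | ⟨H', hr, h⟩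
      · exact S.triv' n1 o1 p1
      · exact (ih H' hr).2.1 (S.Ph p1 hr) h
    · have o12 := S.Pl p22 1 (by omega)
      rcases S.N11 (S.Or o12 1 (by omega)) with h | ⟨H', hr, h⟩
      · exact S.triv' (S.sy (S.Or o12 0 (by omega))) o1 h
      · exact (ih H' hr).2.2 (S.Oh o1 hr) h (S.Ph p22 hr)
    · have o1 := S.Pl p11 0 (by omega)
      rcases S.N1 n1 with h | ⟨H', hr, h⟩
      · exact (S.D 2 le_rfl H).2.2 (S.Or o1 0 (by omega)) h o22
      · exact (ih H' hr).1 (S.Oh o1 hr) h (S.Ph p11 hr) (S.Oh o22 hr)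

theorem F {H : T} (p0 : S.w H 0 0 .P) (n11 : S.w H 1 1 .N) (n22 : S.w H 2 2 .N) : False := by
  rcases S.N22 n22 with ⟨o1, _⟩ | ⟨H', hr, h⟩
  · exact (S.C H).1 p0 o1 n11
  · exact (S.D 2 le_rfl H').2.1 (S.P_N0 h (by omega)) (S.Ph p0 hr) h

theorem G {H : T} (n0 : S.w H 0 0 .N) (o11 : S.w H 1 1 .O) (o22 : S.w H 2 2 .O) : False := by
  obtain ⟨H', hr, h⟩ := S.N0 n0
  exact S.F h (S.Oh o11 hr) (S.Oh o22 hr)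

theorem S1 {H : T} {m : ℕ} (hm : 3 ≤ m) (p22 : S.w H 2 2 .P) (n1m : S.w H 1 m .N) : False := by
  have n0 := S.P_N0 p22 (by omega)
  rcases S.Nc n1m with ⟨k, hk, h⟩ | ⟨k, hk, h⟩ | ⟨H', hr, h⟩
  · obtain rfl : k = 0 := by omega
    exact (S.D 2 le_rfl H).2.1 n0 (S.Pr h 0 (by omega)) p22
  · rcases Nat.eq_zero_or_pos k with rfl | hk0
    · exact (S.D 2 le_rfl H).2.1 n0 (S.Pl h 0 (by omega)) p22
    · exact (S.E H).2.1 (S.sy (S.Pr h 0 hk0)) p22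
  · exact S.G (S.P_N0 h (by omega)) (S.Pr h 1 (by omega)) (S.Ph p22 hr)

theorem U1 {H : T} {m : ℕ} (hm : 3 ≤ m) (p0 : S.w H 0 0 .P) (o2m : S.w H 2 m .O) : False := by
  rcases S.N22 (S.Or o2m 2 (by omega)) with ⟨o1, _⟩ | ⟨H', hr, h⟩
  · exact (S.D m (by omega) H).2.2 (S.Or o1 0 (by omega)) p0 o2m
  · exact (S.D 2 le_rfl H').2.1 (S.P_N0 h (by omega)) (S.Ph p0 hr) h

theorem U2 {H : T} {m : ℕ} (hm : 3 ≤ m) (p2m : S.w H 2 m .P) : False := by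
  obtain ⟨H', hr, h⟩ := S.N0 (S.P_N0 p2m (by omega))
  exact S.U1 hm h (S.Ph p2m hr)

/-- If `H + *2 + *m` is a win for `N` then either `O` wins `H + *1` or `P` wins `H+*2+*2`. -/
theorem N2m {H : T} {m : ℕ} (hm : 3 ≤ m) (n2m : S.w H 2 m .N) :
    S.w H 0 1 .O ∨ S.w H 2 2 .P := by
  rcases S.Nc n2m with ⟨k, hk, h⟩ | ⟨k, hk, h⟩ | ⟨H', hr, h⟩
  · obtain rfl | rfl : k = 0 ∨ k = 1 := by omega
    · exact .inl (S.Pr h 1 (by omega))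
    · exact .inl (S.sy (S.Pr h 0 (by omega)))
  · obtain rfl | rfl | rfl | hk3 : k = 0 ∨ k = 1 ∨ k = 2 ∨ 3 ≤ k := by omega
    · exact .inl (S.sy (S.Pl h 1 (by omega)))
    · exact .inl (S.Pl h 0 (by omega))
    · exact .inr h
    · exact (S.U2 hk3 h).elim
  · exact (S.U2 hm h).elim

theorem A {H : T} {m : ℕ} (hm : 3 ≤ m) (o1m : S.w H 1 m .O) (o2m : S.w H 2 m .O) : False := by
  rcases S.N22 (S.Or o2m 2 (by omega)) with ⟨o1, h | h⟩ | ⟨H', hr, h⟩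
  · have o0 := S.Pr h 0 (by omega)
    rcases S.N1 (S.sy (S.Or o1m 0 (by omega))) with h' | ⟨H', hr, h'⟩
    · exact S.triv' (S.Or o1 0 (by omega)) o0 h'
    · rcases S.N2m hm (S.Oh o2m hr) with h1 | h1
      · exact S.triv' (S.Oh o1 hr) h1 h'
      · exact S.S1 hm h1 (S.Oh o1m hr)
  · obtain ⟨H', hr, h'⟩ := S.N0 (S.Or o1 0 (by omega))
    rcases S.N2m hm (S.Oh o2m hr) with h1 | h1
    · exact (S.C H').1 h' h1 (S.Oh (S.Pr h 1 (by omega)) hr)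
    · exact S.S1 hm h1 (S.Oh o1m hr)
  · exact S.S1 hm h (S.Oh o1m hr)

theorem not_P {H : T} {m n : ℕ} (hm : 3 ≤ m) (hn : 3 ≤ n) (h : S.w H n m .P) : False :=
  S.A hm (S.Pl h 1 (by omega)) (S.Pl h 2 (by omega))

end Sys

theorem u_sw1 {D : IGame} {a b c : ℕ} {p : Player} (h : u D a b c p) : u D b a c p :=
  (u_symm _ D a b c p (Nat.lt_succ_self _) h).1

theorem u_sw2 {D : IGame} {a b c : ℕ} {p : Player} (h : u D a b c p) : u D a c b p :=
  (u_symm _ D a b c p (Nat.lt_succ_self _) h).2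

/-- The system of games `*k + D`. -/
def nimSys : Sys (ℕ × IGame) where
  r x y := (x.1 < y.1 ∧ x.2 = y.2) ∨ (x.1 = y.1 ∧ x.2 ∈ y.2.opts)
  wf := by
    refine Subrelation.wf (r := InvImage (· < ·) fun x : ℕ × IGame => x.1 + sizeOf x.2) ?_
      (InvImage.wf _ Nat.lt_wfRel.wf)
    rintro ⟨a, D⟩ ⟨b, E⟩ (⟨h1, h2⟩ | ⟨h1, h2⟩)
    · simp only at h1 h2
      subst h2
      simp only [InvImage]
      omega
    · simp only at h1 h2
      have := sizeOf_lt_of_mem h2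
      simp only [InvImage]
      omega
  w x i j p := u x.2 x.1 i j p
  sy h := u_sw2 h
  Pl h k hk := (u_P.1 h).2.1 k hk
  Ph := by
    rintro ⟨a, D⟩ i j h ⟨b, E⟩ (⟨h1, h2⟩ | ⟨h1, h2⟩)
    · simp only at h1 h2 h ⊢
      subst h2
      exact (u_P.1 h).1 _ h1
    · simp only at h1 h2 h ⊢
      subst h1
      exact (u_P.1 h).2.2.2 _ h2
  Ol h k hk := (u_O.1 h).2.1 k hk
  Oh := by
    rintro ⟨a, D⟩ i j h ⟨b, E⟩ (⟨h1, h2⟩ | ⟨h1, h2⟩)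
    · simp only at h1 h2 h ⊢
      subst h2
      exact (u_O.1 h).1 _ h1
    · simp only at h1 h2 h ⊢
      subst h1
      exact (u_O.1 h).2.2.2 _ h2
  Nc := by
    rintro ⟨a, D⟩ i j h
    rcases u_N.1 h with ⟨k, hk, h⟩ | ⟨k, hk, h⟩ | ⟨k, hk, h⟩ | ⟨d, hd, h⟩
    · exact .inr (.inr ⟨(k, D), .inl ⟨hk, rfl⟩, h⟩)
    · exact .inl ⟨k, hk, h⟩
    · exact .inr (.inl ⟨k, hk, h⟩)
    · exact .inr (.inr ⟨(a, d), .inr ⟨rfl, hd⟩, h⟩)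

theorem not_uP {D : IGame} {a b c : ℕ} (hb : 3 ≤ b) (hc : 3 ≤ c) (h : u D a b c .P) : False :=
  nimSys.not_P (H := (a, D)) hc hb h

theorem not_uN {D : IGame} {a b c : ℕ} (ha : 3 ≤ a) (hb : 3 ≤ b) (hc : 3 ≤ c)
    (h : u D a b c .N) : False := by
  rcases u_N.1 h with ⟨k, hk, h⟩ | ⟨k, hk, h⟩ | ⟨k, hk, h⟩ | ⟨d, hd, h⟩
  · exact not_uP hb hc h
  · exact not_uP ha hc (u_sw1 h)
  · exact not_uP ha hb (u_sw1 (u_sw2 h))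
  · exact not_uP hb hc h

theorem not_uO {D : IGame} {a b c : ℕ} (ha : 3 ≤ a) (hb : 3 ≤ b) (hc : 3 ≤ c)
    (h : u D a b c .O) : False := by
  obtain ⟨h1, h2, h3, h4⟩ := u_O.1 h
  cases hD : D.opts with
  | cons d l =>
    exact not_uN ha hb hc (h4 d (by rw [hD]; simp))
  | nil =>
    -- two heaps `*b + *c` with both at least three: the first player loses
    have z : u D 0 0 0 .N → False := by
      intro h
      rcases u_N.1 h with ⟨k, hk, h⟩ | ⟨k, hk, h⟩ | ⟨k, hk, h⟩ | ⟨d, hd, h⟩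
      · omega
      · omega
      · omega
      · rw [hD] at hd; simp at hd
    have one : ∀ k, 0 < k → u D 0 0 k .O → False := fun k hk h => z ((u_O.1 h).2.2.1 0 hk)
    have two : ∀ j k, 2 ≤ k → u D 0 j k .P → False := by
      intro j k hk h
      rcases Nat.eq_zero_or_pos j with rfl | hj
      · exact one 1 one_pos ((u_P.1 h).2.2.1 1 (by omega))
      · exact one k (by omega) ((u_P.1 h).2.1 0 hj)
    rcases u_N.1 (h1 0 (by omega)) with ⟨k, hk, h⟩ | ⟨k, hk, h⟩ | ⟨k, hk, h⟩ | ⟨d, hd, h⟩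
    · omega
    · exact two k c (by omega) h
    · exact two k b (by omega) (u_sw2 h)
    · rw [hD] at hd; simp at hd

end IGame

open IGame in
/-- `*m₁ + *m₂ + *m₃` is absorbing whenever `m₁, m₂, m₃ ≥ 3`. -/
theorem nim_three_heaps_absorbing (m₁ m₂ m₃ : ℕ)
    (h₁ : 3 ≤ m₁) (h₂ : 3 ≤ m₂) (h₃ : 3 ≤ m₃) :
    ∀ H : IGame,
      IGame.outcome
        (IGame.add (IGame.add (IGame.add (IGame.nim m₁) (IGame.nim m₂)) (IGame.nim m₃)) H) = ∅ := by
  intro H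
  rw [Set.eq_empty_iff_forall_notMem]
  intro p hp
  have hu : u H m₁ m₂ m₃ p := hp
  cases p with
  | N => exact not_uN h₁ h₂ h₃ hu
  | O => exact not_uO h₁ h₂ h₃ hu
  | P => exact not_uP h₂ h₃ hu
end
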